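/- arXiv:2511.04585 — 3 statements merged into one kernel-verified Lean document; each statement's English description precedes it below -/
import Mathlib

section
/- Let p > 1 be an odd integer such that p + 1 is a power of two. Then every positive integer n can be written as a sum n = b₁ + ... + b_r of distinct elements of A_p with b₁ < ... < b_r < 2(p+1)·b₁. -/
/-- least exponent `x` with `m ≤ 2^x p^y`. -/
noncomputable def eE (p m y : ℕ) : ℕ := sInf {x | m ≤ 2 ^ x * p ^ y}

lemma eE_spec {p : ℕ} (hp : 0 < p) (m y : ℕ) : m ≤ 2 ^ (eE p m y) * p ^ y := by
  have hne : {x | m ≤ 2 ^ x * p ^ y}.Nonempty := by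
    refine ⟨m, ?_⟩
    have h1 : m < 2 ^ m := Nat.lt_two_pow_self
    have h2 : 0 < p ^ y := Nat.pow_pos hp
    show m ≤ 2 ^ m * p ^ y
    nlinarith
  exact Nat.sInf_mem hne

lemma eE_le {p m y x : ℕ} (h : m ≤ 2 ^ x * p ^ y) : eE p m y ≤ x := Nat.sInf_le h

lemma eE_lt {p m y : ℕ} (h : 0 < eE p m y) : 2 ^ (eE p m y) * p ^ y < 2 * m := by
  by_contra hc
  push Not at hc
  obtain ⟨t, ht⟩ : ∃ t, eE p m y = t + 1 := ⟨eE p m y - 1, by omega⟩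
  have : eE p m y ≤ t := by
    apply eE_le
    rw [ht, pow_succ] at hc
    nlinarith
  omega

lemma eE_anti {p : ℕ} (hp : 0 < p) (m y : ℕ) : eE p m (y + 1) ≤ eE p m y := by
  apply eE_le
  refine (eE_spec hp m y).trans ?_
  rw [pow_succ]
  have : 0 < 2 ^ (eE p m y) * p ^ y := by positivity
  nlinarith

lemma eE_succ {p : ℕ} (hp : 0 < p) (m y : ℕ) :
    eE p (m + 1) y = eE p m y ∨
      (2 ^ (eE p m y) * p ^ y = m ∧ eE p (m + 1) y = eE p m y + 1) := by
  have h0 := eE_spec hp m y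
  have hle : eE p m y ≤ eE p (m + 1) y := eE_le ((Nat.le_succ m).trans (eE_spec hp (m + 1) y))
  rcases h0.eq_or_lt with h | h
  · right
    refine ⟨h.symm, le_antisymm ?_ ?_⟩
    · apply eE_le
      have : 0 < 2 ^ (eE p m y) * p ^ y := by positivity
      rw [pow_succ]
      nlinarith
    · by_contra hc
      have : eE p (m + 1) y = eE p m y := by omega
      have h3 := eE_spec hp (m + 1) y
      rw [this] at h3
      omega
  · left
    exact le_antisymm (eE_le h) hle

lemma row_unique {p : ℕ} (hp : Odd p) (hp1 : 1 < p) {x y x' y' : ℕ}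
    (h : 2 ^ x * p ^ y = 2 ^ x' * p ^ y') : y = y' := by
  have hc : ∀ a b, Nat.Coprime (p ^ a) (2 ^ b) := fun a b =>
    (Nat.Coprime.pow _ _ (Nat.coprime_two_right.mpr hp))
  apply Nat.pow_right_injective hp1
  apply Nat.dvd_antisymm
  · exact (hc y x').dvd_of_dvd_mul_left (h ▸ Dvd.intro_left _ rfl)
  · exact (hc y' x).dvd_of_dvd_mul_left (h ▸ Dvd.intro_left _ rfl)

/-- the bound -/
noncomputable def cC (p m : ℕ) : ℕ → ℤ
  | 0 => 0
  | j + 1 => cC p m j + (p : ℤ) ^ (j + 1) * (2 ^ (eE p m j) - 2 ^ (eE p m (j + 1)))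

lemma cC_nonneg {p : ℕ} (hp : 0 < p) (m j : ℕ) : 0 ≤ cC p m j := by
  induction j with
  | zero => simp [cC]
  | succ j ih =>
    have h : (2 : ℤ) ^ (eE p m (j + 1)) ≤ 2 ^ (eE p m j) :=
      pow_le_pow_right₀ (by norm_num) (eE_anti hp m j)
    have : 0 ≤ (p : ℤ) ^ (j + 1) * (2 ^ (eE p m j) - 2 ^ (eE p m (j + 1))) :=
      mul_nonneg (by positivity) (by linarith)
    simp only [cC]
    linarith

lemma cC_diff {p : ℕ} (hp : 0 < p) (m j : ℕ) :
    cC p (m + 1) j - cC p m j ≤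
      p * ∑ y ∈ Finset.range j, (p : ℤ) ^ y * (2 ^ (eE p (m + 1) y) - 2 ^ (eE p m y)) := by
  induction j with
  | zero => simp [cC]
  | succ j ih =>
    rw [Finset.sum_range_succ]
    simp only [cC]
    have h : (2 : ℤ) ^ (eE p m (j + 1)) ≤ 2 ^ (eE p (m + 1) (j + 1)) :=
      pow_le_pow_right₀ (by norm_num) (by rcases eE_succ hp m (j + 1) with h | h <;> omega)
    have : 0 ≤ (p : ℤ) ^ (j + 1) * (2 ^ (eE p (m + 1) (j + 1)) - 2 ^ (eE p m (j + 1))) :=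
      mul_nonneg (by positivity) (by linarith)
    have h2 : (p : ℤ) ^ (j + 1) = p * p ^ j := by ring
    rw [mul_add, ← mul_assoc, ← h2]
    linarith

lemma v_sum {p : ℕ} (hp : Odd p) (hp1 : 1 < p) (m j : ℕ) :
    ∑ y ∈ Finset.range j, (p : ℤ) ^ y * (2 ^ (eE p (m + 1) y) - 2 ^ (eE p m y)) ≤ m := by
  have hp0 : 0 < p := by omega
  by_cases hex : ∃ y, 2 ^ (eE p m y) * p ^ y = m
  · obtain ⟨y, hy⟩ := hex
    have hz : ∀ z, z ≠ y → (p : ℤ) ^ z * (2 ^ (eE p (m + 1) z) - 2 ^ (eE p m z)) = 0 := by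
      intro z hzy
      rcases eE_succ hp0 m z with h | ⟨h, -⟩
      · simp [h]
      · exact absurd (row_unique hp hp1 (h.trans hy.symm)) hzy
    have hv : (p : ℤ) ^ y * (2 ^ (eE p (m + 1) y) - 2 ^ (eE p m y)) ≤ m := by
      rcases eE_succ hp0 m y with h | ⟨h, h'⟩
      · simp [h]
      · rw [h', pow_succ]
        have : (2 : ℤ) ^ (eE p m y) * p ^ y = m := by exact_mod_cast h
        linarith
    by_cases hj : y ∈ Finset.range j
    · rw [Finset.sum_eq_single_of_mem y hj (fun z _ h => hz z h)]
      exact hv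
    · rw [Finset.sum_eq_zero]
      · positivity
      · intro z h
        exact hz z (fun h' => hj (h' ▸ h))
  · rw [Finset.sum_eq_zero]
    · positivity
    · intro z _
      rcases eE_succ hp0 m z with h | ⟨h, -⟩
      · simp [h]
      · exact absurd ⟨z, h⟩ hex

lemma block (P : ℕ) (hP : 0 < P) (s : ℕ) : ∀ d < 2 ^ s, ∃ B : Finset ℕ,
    (∀ b ∈ B, ∃ i < s, b = 2 ^ i * P) ∧ ∑ b ∈ B, b = P * d := by
  induction s with
  | zero =>
    intro d hd
    exact ⟨∅, by simp, by simp at hd; simp [hd]⟩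
  | succ s ih =>
    intro d hd
    by_cases h : d < 2 ^ s
    · obtain ⟨B, h1, h2⟩ := ih d h
      refine ⟨B, fun b hb => ?_, h2⟩
      obtain ⟨i, hi, e⟩ := h1 b hb
      exact ⟨i, by omega, e⟩
    · obtain ⟨t, rfl⟩ : ∃ t, d = 2 ^ s + t := ⟨d - 2 ^ s, by omega⟩
      obtain ⟨B, h1, h2⟩ := ih t (by rw [pow_succ] at hd; omega)
      have hn : 2 ^ s * P ∉ B := by
        intro hb
        obtain ⟨i, hi, e⟩ := h1 _ hb
        have := Nat.pow_right_injective (le_refl 2) (Nat.eq_of_mul_eq_mul_right hP e)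
        omega
      refine ⟨insert (2 ^ s * P) B, fun b hb => ?_, ?_⟩
      · rcases Finset.mem_insert.mp hb with rfl | hb
        · exact ⟨s, by omega, rfl⟩
        · obtain ⟨i, hi, e⟩ := h1 b hb
          exact ⟨i, by omega, e⟩
      · rw [Finset.sum_insert hn, h2]
        ring

lemma exists_res {q : ℕ} (hq : Odd q) (s N : ℕ) : ∃ d : ℕ, d < 2 ^ s ∧ ((2 : ℤ) ^ s) ∣ N - q * d := by
  have hc : Nat.Coprime q (2 ^ s) := (Nat.coprime_two_right.mpr hq).pow_right s
  have hpos : 0 < 2 ^ s := by positivity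
  have : NeZero (2 ^ s) := ⟨hpos.ne'⟩
  refine ⟨((N : ZMod (2 ^ s)) * (q : ZMod (2 ^ s))⁻¹).val, ZMod.val_lt _, ?_⟩
  have : ((2 ^ s : ℕ) : ℤ) ∣ N - q * ((N : ZMod (2 ^ s)) * (q : ZMod (2 ^ s))⁻¹).val := by
    rw [← ZMod.intCast_zmod_eq_zero_iff_dvd]
    have h1 := ZMod.coe_mul_inv_eq_one q hc
    rw [Int.cast_sub, Int.cast_mul, Int.cast_natCast, Int.cast_natCast, Int.cast_natCast, ZMod.natCast_zmod_val]
    linear_combination (-(N : ZMod (2 ^ s))) * h1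
  exact_mod_cast this

lemma rep {p k : ℕ} (hp : Odd p) (hp1 : 1 < p) (hpow : p + 1 = 2 ^ k) (m : ℕ) (hm : 0 < m)
    (j : ℕ) : ∀ n : ℕ, 2 ^ (eE p m j) ∣ n → cC p m j ≤ n → (n : ℤ) ≤ cC p m j + 2 * p * m →
    ∃ B : Finset ℕ, (∀ b ∈ B, m ≤ b ∧ b < 2 * (p + 1) * m ∧ ∃ x y, y ≤ j ∧ b = 2 ^ x * p ^ y) ∧
      ∑ b ∈ B, b = n := by
  have hp0 : 0 < p := by omega
  induction j with
  | zero =>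
    intro n hd _ hn
    obtain ⟨d, rfl⟩ := hd
    have hs := eE_spec hp0 m 0
    have hlt : 2 ^ eE p m 0 < 2 * m := by
      rcases Nat.eq_zero_or_pos (eE p m 0) with h | h
      · rw [h]; omega
      · simpa using eE_lt h
    simp only [pow_zero, mul_one] at hs
    have hn' : 2 ^ eE p m 0 * d ≤ 2 * p * m := by
      simp only [cC, zero_add] at hn
      exact_mod_cast hn
    have hdb : d < 2 ^ (k + 1) := by
      rw [pow_succ, ← hpow]
      by_contra hc
      push Not at hc
      have : m * ((p + 1) * 2) ≤ 2 ^ eE p m 0 * d := Nat.mul_le_mul hs hc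
      nlinarith
    obtain ⟨B, h1, h2⟩ := block (2 ^ eE p m 0) (by positivity) (k + 1) d hdb
    refine ⟨B, fun b hb => ?_, h2⟩
    obtain ⟨i, hi, rfl⟩ := h1 b hb
    have h3 : 1 ≤ 2 ^ i := Nat.one_le_two_pow
    have h4 : 2 ^ i ≤ 2 ^ k := Nat.pow_le_pow_right (by norm_num) (by omega)
    refine ⟨by nlinarith, ?_, i + eE p m 0, 0, le_refl _, by simp [pow_add]⟩
    rw [← hpow] at h4
    nlinarith
  | succ j ih =>
    intro n hd hn1 hn2
    have hanti := eE_anti hp0 m j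
    rcases Nat.eq_zero_or_pos (eE p m j) with hx | hx
    · have hx1 : eE p m (j + 1) = 0 := by omega
      simp only [cC, hx, hx1, sub_self, mul_zero, add_zero] at hn1 hn2
      obtain ⟨B, h1, h2⟩ := ih n (by simp [hx]) hn1 hn2
      refine ⟨B, fun b hb => ?_, h2⟩
      obtain ⟨a, b', x, y, c, d⟩ := h1 b hb
      exact ⟨a, b', x, y, by omega, d⟩
    · have hlt := eE_lt hx
      have hsp := eE_spec hp0 m (j + 1)
      obtain ⟨s, hs⟩ : ∃ s, eE p m j = eE p m (j + 1) + s := ⟨_, (Nat.add_sub_of_le hanti).symm⟩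
      obtain ⟨N, rfl⟩ := hd
      obtain ⟨d0, hd0, hdv⟩ := exists_res (hp.pow (n := j + 1)) s N
      set e := eE p m (j + 1) with he
      set P := 2 ^ e * p ^ (j + 1) with hP
      have hPpos : 0 < P := by positivity
      have hPs : P * 2 ^ s < 2 * p * m := by
        have : P * 2 ^ s = p * (2 ^ eE p m j * p ^ j) := by
          rw [hP, hs]; ring
        rw [this]
        nlinarith
      have hC : cC p m (j + 1) = cC p m j + (P * 2 ^ s - P : ℤ) := by
        simp only [cC, ← he, hs, hP]
        push_cast
        ring
      rw [hC] at hn1 hn2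
      have hPs' : (P : ℤ) * 2 ^ s < 2 * p * m := by exact_mod_cast hPs
      have hd0' : (P : ℤ) * (d0 + 1) ≤ P * 2 ^ s := by
        have : d0 + 1 ≤ 2 ^ s := hd0
        exact_mod_cast Nat.mul_le_mul_left P this
      obtain ⟨d, hdlt, hdvd, hl, hu⟩ : ∃ d : ℕ, d < 2 ^ (s + 1) ∧
          (2 : ℤ) ^ s ∣ N - (p ^ (j + 1) : ℕ) * d ∧
          cC p m j ≤ ((2 ^ e * N : ℕ) : ℤ) - P * d ∧
          ((2 ^ e * N : ℕ) : ℤ) - P * d ≤ cC p m j + 2 * p * m := by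
        by_cases hc : ((2 ^ e * N : ℕ) : ℤ) - P * d0 ≤ cC p m j + 2 * p * m
        · exact ⟨d0, by rw [pow_succ]; omega, hdv, by linarith, hc⟩
        · refine ⟨d0 + 2 ^ s, by rw [pow_succ]; omega, ?_, ?_, ?_⟩
          · have : (N : ℤ) - (p ^ (j + 1) : ℕ) * ((d0 + 2 ^ s : ℕ) : ℤ)
              = (N - (p ^ (j + 1) : ℕ) * d0) - (2 : ℤ) ^ s * (p ^ (j + 1) : ℕ) := by
              push_cast; ring
            rw [this]
            exact dvd_sub hdv (dvd_mul_right _ _)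
          · push Not at hc
            push_cast at hc ⊢
            linarith
          · have : 0 ≤ (P : ℤ) * d0 := by positivity
            push_cast at hn2 ⊢
            linarith
      have hCn := cC_nonneg hp0 m j
      obtain ⟨n', hn'⟩ := Int.eq_ofNat_of_zero_le (hCn.trans hl)
      rw [hn'] at hl hu
      have hdn : 2 ^ eE p m j ∣ n' := by
        have : ((2 ^ eE p m j : ℕ) : ℤ) ∣ (n' : ℤ) := by
          obtain ⟨c, hc⟩ := hdvd
          refine ⟨c, ?_⟩
          rw [← hn', hs, hP]
          push_cast at hc ⊢
          rw [pow_add]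
          linear_combination (2 : ℤ) ^ e * hc
        exact_mod_cast this
      obtain ⟨B, h1, h2⟩ := ih n' hdn hl hu
      obtain ⟨D, g1, g2⟩ := block P hPpos (s + 1) d hdlt
      have hdisj : Disjoint B D := by
        rw [Finset.disjoint_left]
        intro b hb hb'
        obtain ⟨-, -, x, y, hy, e1⟩ := h1 b hb
        obtain ⟨i, -, e2⟩ := g1 b hb'
        have : y = j + 1 := row_unique hp hp1 (x := x) (x' := i + e) (by
          rw [← e1, e2, hP]; ring)
        omega
      refine ⟨B ∪ D, fun b hb => ?_, ?_⟩
      · rcases Finset.mem_union.mp hb with hb | hb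
        · obtain ⟨a, b', x, y, c, d⟩ := h1 b hb
          exact ⟨a, b', x, y, by omega, d⟩
        · obtain ⟨i, hi, rfl⟩ := g1 b hb
          have h3 : 1 ≤ 2 ^ i := Nat.one_le_two_pow
          have h4 : 2 ^ i ≤ 2 ^ s := Nat.pow_le_pow_right (by norm_num) (by omega)
          refine ⟨by nlinarith, ?_, i + e, j + 1, le_refl _, by rw [hP]; ring⟩
          have : 2 ^ i * P ≤ 2 ^ s * P := Nat.mul_le_mul_right P h4
          nlinarith
      · rw [Finset.sum_union hdisj, h2, g2]
        zify
        rw [← hn']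
        push_cast
        ring

lemma cover {p k : ℕ} (hp : Odd p) (hp1 : 1 < p) (hpow : p + 1 = 2 ^ k) (J m : ℕ) :
    m + 1 ≤ p ^ J → ∀ n : ℕ, (n : ℤ) ≤ cC p (m + 1) J + 2 * p * (m + 1 : ℕ) →
    ∃ q, ∃ B : Finset ℕ, (∀ b ∈ B, q ≤ b ∧ b < 2 * (p + 1) * q ∧ ∃ x y, b = 2 ^ x * p ^ y) ∧
      ∑ b ∈ B, b = n := by
  have hp0 : 0 < p := by omega
  have key : ∀ m, m + 1 ≤ p ^ J → ∀ n : ℕ, cC p (m + 1) J ≤ n →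
      (n : ℤ) ≤ cC p (m + 1) J + 2 * p * (m + 1 : ℕ) →
    ∃ q, ∃ B : Finset ℕ, (∀ b ∈ B, q ≤ b ∧ b < 2 * (p + 1) * q ∧ ∃ x y, b = 2 ^ x * p ^ y) ∧
      ∑ b ∈ B, b = n := by
    intro m hm n h1 h2
    have h0 : eE p (m + 1) J = 0 := Nat.le_zero.mp (eE_le (by simpa using hm))
    obtain ⟨B, a, b⟩ := rep hp hp1 hpow (m + 1) (by omega) J n (by simp [h0]) h1 h2
    refine ⟨m + 1, B, fun c hc => ?_, b⟩
    obtain ⟨u, v, x, y, -, w⟩ := a c hc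
    exact ⟨u, v, x, y, w⟩
  induction m with
  | zero =>
    intro hm n hn
    refine key 0 hm n ?_ hn
    have h0 : ∀ y, eE p (0 + 1) y = 0 := fun y =>
      Nat.le_zero.mp (eE_le (by have : 0 < p ^ y := by positivity
                                simp; omega))
    have : ∀ j, cC p (0 + 1) j = 0 := by
      intro j
      induction j with
      | zero => rfl
      | succ j ih => simp only [cC, ih, h0]; simp
    rw [this]
    positivity
  | succ m ih =>
    intro hm n hn
    by_cases hc : cC p (m + 1 + 1) J ≤ n
    · exact key (m + 1) hm n hc hn
    · apply ih (by omega) n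
      have h1 := cC_diff hp0 (m + 1) J
      have h2 := mul_le_mul_of_nonneg_left (v_sum hp hp1 (m + 1) J) (Int.natCast_nonneg p)
      have h3 : (0 : ℤ) ≤ p * (m + 1 : ℕ) := by positivity
      linarith

theorem Ap_small_spacing_p_succ_pow2 (p : ℕ) (hp : Odd p) (hp1 : 1 < p)
    (hpow : ∃ k : ℕ, p + 1 = 2 ^ k) (n : ℕ) (hn : 0 < n) :
    ∃ B : Finset ℕ, ∃ hB : B.Nonempty,
      (∀ b ∈ B, ∃ x y : ℕ, b = 2 ^ x * p ^ y) ∧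
      (∑ b ∈ B, b) = n ∧
      (∀ b ∈ B, b < 2 * (p + 1) * B.min' hB) := by
  obtain ⟨k, hk⟩ := hpow
  have hp0 : 0 < p := by omega
  obtain ⟨m, rfl⟩ : ∃ m, n = m + 1 := ⟨n - 1, by omega⟩
  obtain ⟨q, B, h1, h2⟩ := cover hp hp1 hk (m + 1) m (Nat.lt_pow_self hp1).le (m + 1) (by
    have h := cC_nonneg hp0 (m + 1) (m + 1)
    have : ((m + 1 : ℕ) : ℤ) ≤ 2 * p * (m + 1 : ℕ) := by
      have : m + 1 ≤ 2 * p * (m + 1) := by nlinarith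
      exact_mod_cast this
    linarith)
  have hB : B.Nonempty := by
    rw [Finset.nonempty_iff_ne_empty]
    rintro rfl
    simp at h2
  refine ⟨B, hB, fun b hb => (h1 b hb).2.2, h2, fun b hb => ?_⟩
  have hq := (h1 _ (B.min'_mem hB)).1
  exact (h1 b hb).2.1.trans_le (Nat.mul_le_mul_left _ hq)
end

section
/- Let p > 1 be an odd integer such that p − 1 is a power of two. Then every positive integer n can be written as a sum n = b₁ + ... + b_r of distinct elements of A_p with b₁ < ... < b_r < 2p·b₁. -/
/-- subset sums of a block `u, 2u, ..., 2^(e-1) u` -/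
theorem Ap_layer (u : ℕ) (hu : 0 < u) (e : ℕ) : ∀ j : ℕ, j < 2 ^ e →
    ∃ S : Finset ℕ, (∑ b ∈ S, b) = j * u ∧ ∀ b ∈ S, ∃ i, i < e ∧ b = 2 ^ i * u := by
  induction e with
  | zero =>
    intro j hj
    refine ⟨∅, ?_, by simp⟩
    have : j = 0 := by simpa using hj
    simp [this]
  | succ e ih =>
    intro j hj
    by_cases h : j < 2 ^ e
    · obtain ⟨S, h1, h2⟩ := ih j h
      exact ⟨S, h1, fun b hb => by
        obtain ⟨i, hi, hb⟩ := h2 b hb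
        exact ⟨i, by omega, hb⟩⟩
    · push Not at h
      obtain ⟨t, rfl⟩ := Nat.exists_eq_add_of_le h
      obtain ⟨S, h1, h2⟩ := ih t (by rw [pow_succ] at hj; omega)
      have hn : 2 ^ e * u ∉ S := by
        intro hm
        obtain ⟨i, hi, hb⟩ := h2 _ hm
        have := Nat.eq_of_mul_eq_mul_right hu hb
        have := Nat.pow_right_injective (le_refl 2) this
        omega
      refine ⟨insert (2 ^ e * u) S, ?_, ?_⟩
      · rw [Finset.sum_insert hn, h1]; ring
      · intro b hb
        rcases Finset.mem_insert.1 hb with rfl | hb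
        · exact ⟨e, by omega, rfl⟩
        · obtain ⟨i, hi, hb⟩ := h2 b hb
          exact ⟨i, by omega, hb⟩

theorem Ap_inj (p : ℕ) (hp : Odd p) (hp1 : 1 < p) (x y x' y' : ℕ)
    (h : 2 ^ x * p ^ y = 2 ^ x' * p ^ y') : y = y' := by
  have hc : ∀ s t : ℕ, Nat.Coprime (p ^ s) (2 ^ t) := fun s t =>
    Nat.Coprime.pow _ _ (Nat.coprime_two_right.2 hp)
  have h1 : p ^ y ∣ p ^ y' := by
    apply (hc y x').dvd_of_dvd_mul_left
    rw [← h]; exact Dvd.intro_left _ rfl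
  have h2 : p ^ y' ∣ p ^ y := by
    apply (hc y' x).dvd_of_dvd_mul_left
    rw [h]; exact Dvd.intro_left _ rfl
  exact Nat.pow_right_injective hp1 (Nat.dvd_antisymm h1 h2)

/-- residues: solve `2^d ∣ m - r c` with `c` odd -/
theorem Ap_res (c d m : ℕ) (hc : Odd c) : ∃ r : ℕ, r < 2 ^ d ∧ ((2 : ℤ) ^ d ∣ (m : ℤ) - r * c) := by
  have hpos : 0 < 2 ^ d := by positivity
  have hcop : Nat.Coprime c (2 ^ d) := Nat.Coprime.pow_right _ (Nat.coprime_two_right.2 hc)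
  haveI : NeZero (2 ^ d) := ⟨hpos.ne'⟩
  let U := ZMod.unitOfCoprime c hcop
  refine ⟨((m : ZMod (2 ^ d)) * ((U⁻¹ : (ZMod (2 ^ d))ˣ) : ZMod (2 ^ d))).val, ZMod.val_lt _, ?_⟩
  have : (((2 ^ d : ℕ) : ℤ)) ∣ (m : ℤ) - ((m : ZMod (2 ^ d)) * ((U⁻¹ : (ZMod (2 ^ d))ˣ) : ZMod (2 ^ d))).val * c := by
    rw [← ZMod.intCast_zmod_eq_zero_iff_dvd]
    push_cast
    rw [ZMod.natCast_zmod_val]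
    have hU : ((U⁻¹ : (ZMod (2 ^ d))ˣ) : ZMod (2 ^ d)) * (c : ZMod (2 ^ d)) = 1 := by
      have : (c : ZMod (2 ^ d)) = (U : ZMod (2 ^ d)) := (ZMod.coe_unitOfCoprime c hcop).symm
      rw [this]; exact Units.inv_mul U
    rw [mul_assoc, hU]; ring
  exact_mod_cast this

theorem Ap_key (p k : ℕ) (hp : Odd p) (hk : 1 ≤ k) (hpk : p = 2 ^ k + 1) (M : ℕ)
    (a : ℕ → ℕ) (hanti : ∀ y, a (y + 1) ≤ a y) (hM : ∀ y, M ≤ 2 ^ a y * p ^ y)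
    (h0 : 2 ^ a 0 * p ^ 0 < 2 * M) (Y : ℕ) (hY : ∀ y, y < Y → 2 ^ a y * p ^ y < 2 * M) :
    ∀ n : ℕ, 2 ^ a Y ∣ n →
      (∑ y ∈ Finset.range Y, ((p : ℤ) * (2 ^ a y * p ^ y) - 2 ^ a (y + 1) * p ^ (y + 1)) ≤ n) →
      ((n : ℤ) ≤ ∑ y ∈ Finset.range Y, ((p : ℤ) * (2 ^ a y * p ^ y)) +
        (2 * 2 ^ k - 1) * (2 ^ a 0 * p ^ 0)) →
      ∃ S : Finset ℕ, (∀ b ∈ S, (∃ x y, y ≤ Y ∧ b = 2 ^ x * p ^ y) ∧ M ≤ b ∧ b < 2 * p * M) ∧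
        (∑ b ∈ S, b) = n := by
  have hp1 : 1 < p := by have : 0 < 2 ^ k := by positivity
                         omega
  have hup : ∀ y, 0 < 2 ^ a y * p ^ y := fun y => by positivity
  have hk2 : 2 ≤ 2 ^ k := by
    calc 2 = 2 ^ 1 := rfl
      _ ≤ 2 ^ k := Nat.pow_le_pow_right (by norm_num) hk
  have hd : ∀ y, 2 ^ (a y - a (y + 1)) * (2 ^ a (y + 1) * p ^ (y + 1)) = p * (2 ^ a y * p ^ y) := by
    intro y
    have : 2 ^ a y = 2 ^ (a y - a (y + 1)) * 2 ^ a (y + 1) := by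
      rw [← pow_add]; congr 1; have := hanti y; omega
    rw [this]; ring
  -- width bound
  have hw : ∀ y, y < Y → (p : ℤ) * (2 ^ a y * p ^ y) +
      ∑ y ∈ Finset.range y, ((p : ℤ) * (2 ^ a y * p ^ y) - 2 ^ a (y + 1) * p ^ (y + 1)) ≤
      ∑ y ∈ Finset.range y, ((p : ℤ) * (2 ^ a y * p ^ y)) +
        (2 * 2 ^ k - 1) * (2 ^ a 0 * p ^ 0) := by
    intro y
    induction y with
    | zero =>
      intro _
      have h1 : (0 : ℤ) < 2 ^ a 0 * p ^ 0 := by exact_mod_cast hup 0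
      have h2 : (p : ℤ) = 2 ^ k + 1 := by exact_mod_cast hpk
      have h3 : (2 : ℤ) ≤ 2 ^ k := by exact_mod_cast hk2
      simp only [Finset.range_zero, Finset.sum_empty, add_zero, zero_add]
      rw [h2] at *
      apply mul_le_mul_of_nonneg_right _ h1.le
      linarith
    | succ y ih =>
      intro hy
      have ih := ih (by omega)
      rw [Finset.sum_range_succ, Finset.sum_range_succ]
      have hq : 2 ^ k ≤ 2 ^ (a y - a (y + 1)) := by
        apply Nat.pow_le_pow_right (by norm_num)
        by_contra hlt
        push Not at hlt
        have h1 := hd y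
        have h2 := hY _ hy
        have h3 := hM y
        have h4 : 2 * 2 ^ (a y - a (y + 1)) ≤ 2 ^ k := by
          rw [← pow_succ']; exact Nat.pow_le_pow_right (by norm_num) hlt
        set u := 2 ^ a (y + 1) * p ^ (y + 1)
        have h5 : p * u < 2 * 2 ^ (a y - a (y + 1)) * u := by
          calc p * u < p * (2 * M) := Nat.mul_lt_mul_of_pos_left h2 (by omega)
            _ ≤ 2 * (p * (2 ^ a y * p ^ y)) := by nlinarith
            _ = _ := by rw [← h1]; ring
        have h6 := lt_of_mul_lt_mul_right h5 (Nat.zero_le _)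
        omega
      have h1 : (2 : ℤ) ^ (a y - a (y + 1)) * (2 ^ a (y + 1) * p ^ (y + 1)) = p * (2 ^ a y * p ^ y) := by
        exact_mod_cast hd y
      have h2 : (2 : ℤ) ^ k ≤ 2 ^ (a y - a (y + 1)) := by exact_mod_cast hq
      have h3 : (p : ℤ) = 2 ^ k + 1 := by exact_mod_cast hpk
      have h4 : (0 : ℤ) < 2 ^ a (y + 1) * p ^ (y + 1) := by exact_mod_cast hup (y + 1)
      have h5 : (p : ℤ) * (2 ^ a (y + 1) * p ^ (y + 1)) ≤
          p * (2 ^ a y * p ^ y) + 2 ^ a (y + 1) * p ^ (y + 1) := by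
        rw [← h1]
        generalize (2 : ℤ) ^ a (y + 1) * p ^ (y + 1) = u at *
        rw [h3]
        nlinarith
      linarith
  induction Y with
  | zero =>
    intro n hn _ hB
    obtain ⟨m, rfl⟩ := hn
    simp only [Finset.range_zero, Finset.sum_empty, zero_add, pow_zero, mul_one] at hB h0
    have hm : m < 2 ^ (k + 1) := by
      have h1 : (0 : ℤ) < 2 ^ a 0 := by positivity
      push_cast at hB
      rw [mul_comm] at hB
      have := le_of_mul_le_mul_right hB h1
      have h2 : (m : ℤ) < 2 ^ (k + 1) := by rw [pow_succ]; linarith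
      exact_mod_cast h2
    obtain ⟨S, hS1, hS2⟩ := Ap_layer (2 ^ a 0) (by positivity) (k + 1) m hm
    refine ⟨S, ?_, by rw [hS1, mul_comm]⟩
    intro b hb
    obtain ⟨i, hi, rfl⟩ := hS2 b hb
    have hM0 := hM 0
    simp only [pow_zero, mul_one] at hM0
    refine ⟨⟨i + a 0, 0, le_refl _, by rw [pow_add]; simp⟩, ?_, ?_⟩
    · exact hM0.trans (Nat.le_mul_of_pos_left _ (by positivity))
    · have : 2 ^ i ≤ 2 ^ k := Nat.pow_le_pow_right (by norm_num) (by omega)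
      calc 2 ^ i * 2 ^ a 0 ≤ 2 ^ k * 2 ^ a 0 := Nat.mul_le_mul_right _ this
        _ < 2 ^ k * (2 * M) := Nat.mul_lt_mul_of_pos_left h0 (by positivity)
        _ ≤ p * (2 * M) := Nat.mul_le_mul_right _ (by omega)
        _ = _ := by ring
  | succ Y ih =>
    intro n hn hA hB
    have ih := ih (fun y hy => hY y (by omega)) (fun y hy => hw y (by omega))
    have hwY := hw Y (by omega)
    rw [Finset.sum_range_succ] at hA hB
    have hdY := hd Y
    have haY := hanti Y
    obtain ⟨m, hm⟩ := hn
    obtain ⟨r, hr, hrd⟩ := Ap_res (p ^ (Y + 1)) (a Y - a (Y + 1)) m hp.pow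
    -- the chosen digit
    have hchoice : ∃ j : ℕ, j < 2 ^ (a Y - a (Y + 1) + 1) ∧
        ((2 : ℤ) ^ (a Y - a (Y + 1)) ∣ (m : ℤ) - j * (p ^ (Y + 1) : ℕ)) ∧
        (∑ y ∈ Finset.range Y, ((p : ℤ) * (2 ^ a y * p ^ y) - 2 ^ a (y + 1) * p ^ (y + 1)) ≤
          (n : ℤ) - j * (2 ^ a (Y + 1) * p ^ (Y + 1))) ∧
        ((n : ℤ) - j * (2 ^ a (Y + 1) * p ^ (Y + 1)) ≤
          ∑ y ∈ Finset.range Y, ((p : ℤ) * (2 ^ a y * p ^ y)) +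
          (2 * 2 ^ k - 1) * (2 ^ a 0 * p ^ 0)) := by
      have hdZ : (2 : ℤ) ^ (a Y - a (Y + 1)) * (2 ^ a (Y + 1) * p ^ (Y + 1)) = p * (2 ^ a Y * p ^ Y) := by
        exact_mod_cast hdY
      have hu : (0 : ℤ) < 2 ^ a (Y + 1) * p ^ (Y + 1) := by exact_mod_cast hup (Y + 1)
      have hrZ : (r : ℤ) + 1 ≤ 2 ^ (a Y - a (Y + 1)) := by exact_mod_cast hr
      have hru : ((r : ℤ) + 1) * (2 ^ a (Y + 1) * p ^ (Y + 1)) ≤ p * (2 ^ a Y * p ^ Y) := by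
        rw [← hdZ]; exact mul_le_mul_of_nonneg_right hrZ hu.le
      have hr0 : 0 ≤ (r : ℤ) * (2 ^ a (Y + 1) * p ^ (Y + 1)) := by positivity
      by_cases hc : (n : ℤ) - r * (2 ^ a (Y + 1) * p ^ (Y + 1)) ≤
          ∑ y ∈ Finset.range Y, ((p : ℤ) * (2 ^ a y * p ^ y)) +
          (2 * 2 ^ k - 1) * (2 ^ a 0 * p ^ 0)
      · refine ⟨r, by rw [pow_succ]; omega, hrd, ?_, hc⟩
        linarith
      · push Not at hc
        refine ⟨r + 2 ^ (a Y - a (Y + 1)), by rw [pow_succ]; omega, ?_, ?_, ?_⟩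
        · have : (m : ℤ) - ((r + 2 ^ (a Y - a (Y + 1)) : ℕ) : ℤ) * (p ^ (Y + 1) : ℕ) =
            ((m : ℤ) - r * (p ^ (Y + 1) : ℕ)) - 2 ^ (a Y - a (Y + 1)) * (p ^ (Y + 1) : ℕ) := by
            push_cast; ring
          rw [this]
          exact dvd_sub hrd (Dvd.intro _ rfl)
        · push_cast
          rw [add_mul, hdZ]
          linarith
        · push_cast
          rw [add_mul, hdZ]
          linarith
    obtain ⟨j, hj, hjd, hjA, hjB⟩ := hchoice
    have hA0 : (0 : ℤ) ≤
        ∑ y ∈ Finset.range Y, ((p : ℤ) * (2 ^ a y * p ^ y) - 2 ^ a (y + 1) * p ^ (y + 1)) := by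
      apply Finset.sum_nonneg
      intro y _
      have h1 : 2 ^ a (y + 1) * p ^ (y + 1) ≤ p * (2 ^ a y * p ^ y) := by
        rw [← hd y]; exact Nat.le_mul_of_pos_left _ (by positivity)
      have h2 : (2 : ℤ) ^ a (y + 1) * p ^ (y + 1) ≤ p * (2 ^ a y * p ^ y) := by exact_mod_cast h1
      linarith
    have hle : j * (2 ^ a (Y + 1) * p ^ (Y + 1)) ≤ n := by
      have : (j : ℤ) * (2 ^ a (Y + 1) * p ^ (Y + 1)) ≤ n := by linarith
      exact_mod_cast this
    obtain ⟨n', hn'⟩ := Nat.exists_eq_add_of_le hle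
    have hn'Z : (n' : ℤ) = (n : ℤ) - j * (2 ^ a (Y + 1) * p ^ (Y + 1)) := by
      rw [hn']; push_cast; ring
    rw [← hn'Z] at hjA hjB
    have hdvd : 2 ^ a Y ∣ n' := by
      have h1 : (2 : ℤ) ^ a Y = 2 ^ a (Y + 1) * 2 ^ (a Y - a (Y + 1)) := by
        rw [← pow_add]; congr 1; omega
      have h2 : (n' : ℤ) = 2 ^ a (Y + 1) * ((m : ℤ) - j * (p ^ (Y + 1) : ℕ)) := by
        rw [hn'Z, hm]; push_cast; ring
      have h3 : (2 : ℤ) ^ a Y ∣ n' := by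
        rw [h1, h2]; exact mul_dvd_mul_left _ hjd
      exact_mod_cast h3
    obtain ⟨S, hS, hSn⟩ := ih n' hdvd hjA hjB
    obtain ⟨T, hT1, hT2⟩ := Ap_layer _ (hup (Y + 1)) _ j hj
    have hdisj : Disjoint S T := by
      rw [Finset.disjoint_left]
      intro b hb hb'
      obtain ⟨⟨x, y, hy, hxy⟩, _⟩ := hS b hb
      obtain ⟨i, _, hi⟩ := hT2 b hb'
      have : y = Y + 1 := Ap_inj p hp hp1 x y (i + a (Y + 1)) (Y + 1) (by
        rw [← hxy, hi, pow_add]; ring)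
      omega
    refine ⟨S ∪ T, ?_, by rw [Finset.sum_union hdisj, hSn, hT1]; omega⟩
    intro b hb
    rcases Finset.mem_union.1 hb with hb | hb
    · obtain ⟨⟨x, y, hy, hxy⟩, h⟩ := hS b hb
      exact ⟨⟨x, y, by omega, hxy⟩, h⟩
    · obtain ⟨i, hi, hb⟩ := hT2 b hb
      refine ⟨⟨i + a (Y + 1), Y + 1, le_refl _, by rw [hb, pow_add]; ring⟩, ?_, ?_⟩
      · rw [hb]
        exact (hM (Y + 1)).trans (Nat.le_mul_of_pos_left _ (by positivity))
      · have h1 : 2 ^ i ≤ 2 ^ (a Y - a (Y + 1)) := Nat.pow_le_pow_right (by norm_num) (by omega)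
        calc b ≤ 2 ^ (a Y - a (Y + 1)) * (2 ^ a (Y + 1) * p ^ (Y + 1)) := by
              rw [hb]; exact Nat.mul_le_mul_right _ h1
          _ = p * (2 ^ a Y * p ^ Y) := hdY
          _ < p * (2 * M) := Nat.mul_lt_mul_of_pos_left (hY Y (by omega)) (by omega)
          _ = _ := by ring

/-- existence of the least exponents -/
theorem Ap_exp (p : ℕ) (hp1 : 1 < p) : ∃ a : ℕ → ℕ → ℕ, ∀ M y,
    M ≤ 2 ^ a M y * p ^ y ∧ ∀ c, M ≤ 2 ^ c * p ^ y → a M y ≤ c := by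
  have hex : ∀ M y, ∃ c, M ≤ 2 ^ c * p ^ y := fun M y => ⟨M, by
    have h1 : M < 2 ^ M := Nat.lt_two_pow_self
    have h2 : 0 < p ^ y := by positivity
    nlinarith⟩
  exact ⟨fun M y => Nat.find (hex M y), fun M y => ⟨Nat.find_spec (hex M y),
    fun c hc => Nat.find_min' (hex M y) hc⟩⟩

theorem Ap_small_spacing_p_pred_pow2 (p : ℕ) (hp : Odd p) (hp1 : 1 < p)
    (hpow : ∃ k : ℕ, p - 1 = 2 ^ k) (n : ℕ) (hn : 0 < n) :
    ∃ B : Finset ℕ, ∃ hB : B.Nonempty,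
      (∀ b ∈ B, ∃ x y : ℕ, b = 2 ^ x * p ^ y) ∧
      (∑ b ∈ B, b) = n ∧
      (∀ b ∈ B, b < 2 * p * B.min' hB) := by
  obtain ⟨k, hk⟩ := hpow
  have hpk : p = 2 ^ k + 1 := by omega
  have hk1 : 1 ≤ k := by
    rcases Nat.eq_zero_or_pos k with h | h
    · subst h
      obtain ⟨t, ht⟩ := hp
      simp at hk
      omega
    · exact h
  obtain ⟨a, ha⟩ := Ap_exp p hp1
  have hM : ∀ M y, M ≤ 2 ^ a M y * p ^ y := fun M y => (ha M y).1
  have hmin : ∀ M y c, M ≤ 2 ^ c * p ^ y → a M y ≤ c := fun M y => (ha M y).2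
  have hanti : ∀ M y, a M (y + 1) ≤ a M y := by
    intro M y
    apply hmin
    calc M ≤ _ := hM M y
      _ ≤ _ := Nat.mul_le_mul_left _ (Nat.pow_le_pow_right (by omega) (by omega))
  have hlt : ∀ M y, p ^ y < 2 * M → 2 ^ a M y * p ^ y < 2 * M := by
    intro M y h
    rcases Nat.eq_zero_or_pos (a M y) with h0 | h0
    · rw [h0]; simpa using h
    · obtain ⟨c, hc⟩ := Nat.exists_eq_succ_of_ne_zero h0.ne'
      have : ¬ M ≤ 2 ^ c * p ^ y := fun h' => by
        have := hmin M y c h'; omega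
      rw [hc, Nat.succ_eq_add_one, pow_succ]
      nlinarith
  have hzero : ∀ M y, M ≤ p ^ y → a M y = 0 := by
    intro M y h
    have := hmin M y 0 (by simpa using h)
    omega
  -- sliding M by one
  have hstep : ∀ M y, 1 ≤ M → 2 ^ a (M + 1) y * p ^ y =
      2 ^ a M y * p ^ y + if 2 ^ a M y * p ^ y = M then M else 0 := by
    intro M y hM1
    split_ifs with h
    · have h1 : a (M + 1) y = a M y + 1 := by
        apply le_antisymm
        · apply hmin
          rw [pow_succ]
          have : 2 ^ a M y * 2 * p ^ y = 2 * (2 ^ a M y * p ^ y) := by ring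
          rw [this, h]; omega
        · by_contra hc
          push Not at hc
          have h2 : 2 ^ a (M + 1) y ≤ 2 ^ a M y := Nat.pow_le_pow_right (by norm_num) (by omega)
          have h3 := Nat.mul_le_mul_right (p ^ y) h2
          have h4 := hM (M + 1) y
          omega
      rw [h1, pow_succ]
      have : 2 ^ a M y * 2 * p ^ y = 2 * (2 ^ a M y * p ^ y) := by ring
      rw [this, h]; omega
    · have h1 : a (M + 1) y = a M y := by
        apply le_antisymm
        · apply hmin
          have := hM M y
          omega
        · apply hmin
          have := hM (M + 1) y
          omega
      rw [h1, add_zero]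
  set N := n + p + 2 with hN
  let A : ℕ → ℤ := fun M =>
    ∑ y ∈ Finset.range N, ((p : ℤ) * (2 ^ a M y * p ^ y) - 2 ^ a M (y + 1) * p ^ (y + 1))
  have hterm : ∀ M y, (0 : ℤ) ≤ (p : ℤ) * (2 ^ a M y * p ^ y) - 2 ^ a M (y + 1) * p ^ (y + 1) := by
    intro M y
    have h1 : 2 ^ a M (y + 1) ≤ 2 ^ a M y := Nat.pow_le_pow_right (by norm_num) (hanti M y)
    have h2 := Nat.mul_le_mul_right (p ^ (y + 1)) h1
    have h3 : (2 : ℤ) ^ a M (y + 1) * p ^ (y + 1) ≤ 2 ^ a M y * p ^ (y + 1) := by exact_mod_cast h2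
    have h4 : (2 : ℤ) ^ a M y * p ^ (y + 1) = p * (2 ^ a M y * p ^ y) := by ring
    linarith
  have hA1 : A 1 = 0 := by
    apply Finset.sum_eq_zero
    intro y _
    rw [hzero 1 y (Nat.one_le_pow _ _ (by omega)), hzero 1 (y + 1) (Nat.one_le_pow _ _ (by omega))]
    ring
  have hAbig : (n : ℤ) < A (n + p + 1) := by
    have h1 : (p : ℤ) * (2 ^ a (n + p + 1) 0 * p ^ 0) - 2 ^ a (n + p + 1) (0 + 1) * p ^ (0 + 1) ≤
        A (n + p + 1) :=
      Finset.single_le_sum (f := fun y => (p : ℤ) * (2 ^ a (n + p + 1) y * p ^ y) -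
        2 ^ a (n + p + 1) (y + 1) * p ^ (y + 1)) (fun y _ => hterm _ y)
        (Finset.mem_range.2 (by omega))
    have h2 := hM (n + p + 1) 0
    have h3 := hlt (n + p + 1) (0 + 1) (by simp; omega)
    have h4 : ((n : ℤ) + p + 1) ≤ 2 ^ a (n + p + 1) 0 * p ^ 0 := by exact_mod_cast h2
    have h5 : (2 : ℤ) ^ a (n + p + 1) (0 + 1) * p ^ (0 + 1) < 2 * (n + p + 1) := by exact_mod_cast h3
    have h6 : (3 : ℤ) ≤ p := by
      obtain ⟨t, ht⟩ := hp
      have : 3 ≤ p := by omega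
      exact_mod_cast this
    have h7 : (3 : ℤ) * ((n : ℤ) + p + 1) ≤ p * (2 ^ a (n + p + 1) 0 * p ^ 0) :=
      mul_le_mul h6 h4 (by positivity) (by positivity)
    linarith
  have hAtel : ∀ M, A M = ((p : ℤ) - 1) * ∑ y ∈ Finset.range N, ((2 : ℤ) ^ a M y * p ^ y) +
      2 ^ a M 0 * p ^ 0 - 2 ^ a M N * p ^ N := by
    intro M
    have h1 := Finset.sum_range_sub (fun y => (2 : ℤ) ^ a M y * p ^ y) N
    have h2 : A M = ((p : ℤ) - 1) * ∑ y ∈ Finset.range N, ((2 : ℤ) ^ a M y * p ^ y) -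
        ∑ y ∈ Finset.range N, ((2 : ℤ) ^ a M (y + 1) * p ^ (y + 1) - 2 ^ a M y * p ^ y) := by
      rw [Finset.mul_sum, ← Finset.sum_sub_distrib]
      apply Finset.sum_congr rfl
      intro y _; ring
    rw [h2, h1]; ring
  have hAstep : ∀ M, 1 ≤ M → A (M + 1) ≤ A M + p * M := by
    intro M hM1
    have hs : ∀ y, (2 : ℤ) ^ a (M + 1) y * p ^ y =
      2 ^ a M y * p ^ y + if 2 ^ a M y * p ^ y = M then (M : ℤ) else 0 := by
      intro y
      have := hstep M y hM1
      have h2 : ((2 ^ a (M + 1) y * p ^ y : ℕ) : ℤ) =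
        ((2 ^ a M y * p ^ y + if 2 ^ a M y * p ^ y = M then M else 0 : ℕ) : ℤ) := by rw [this]
      push_cast at h2
      exact h2
    have hsum : ∑ y ∈ Finset.range N, (if 2 ^ a M y * p ^ y = M then (M : ℤ) else 0) ≤ M := by
      by_cases hex : ∃ y0, 2 ^ a M y0 * p ^ y0 = M
      · obtain ⟨y0, hy0⟩ := hex
        calc _ ≤ ∑ y ∈ Finset.range N, (if y = y0 then (M : ℤ) else 0) := by
              apply Finset.sum_le_sum
              intro y _
              by_cases h : 2 ^ a M y * p ^ y = M
              · rw [if_pos h, if_pos (Ap_inj p hp hp1 _ _ _ _ (h.trans hy0.symm))]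
              · rw [if_neg h]; split_ifs <;> positivity
          _ ≤ M := by
              rw [Finset.sum_ite_eq']; split_ifs <;> simp
      · push Not at hex
        rw [Finset.sum_eq_zero]
        · positivity
        · intro y _; rw [if_neg (hex y)]
    rw [hAtel, hAtel, Finset.sum_congr rfl (fun y _ => hs y), Finset.sum_add_distrib, hs 0, hs N]
    have h0 : (if 2 ^ a M 0 * p ^ 0 = M then (M : ℤ) else 0) ≤ M := by split_ifs <;> simp
    have hNN : (0 : ℤ) ≤ (if 2 ^ a M N * p ^ N = M then (M : ℤ) else 0) := by split_ifs <;> simp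
    have hp1' : (0 : ℤ) ≤ (p : ℤ) - 1 := by
      have : (1 : ℤ) < p := by exact_mod_cast hp1
      linarith
    have := mul_le_mul_of_nonneg_left hsum hp1'
    linarith
  -- choose M
  have hexM : ∃ M, 1 ≤ M ∧ M ≤ n + p ∧ A M ≤ n ∧ (n : ℤ) < A (M + 1) := by
    by_contra hcon
    push Not at hcon
    have : ∀ M, M ≤ n + p → A (M + 1) ≤ n := by
      intro M
      induction M with
      | zero => intro _; rw [zero_add, hA1]; positivity
      | succ M ih => intro h; exact hcon (M + 1) (by omega) h (ih (by omega))
    have := this (n + p) (le_refl _)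
    linarith
  obtain ⟨M, hM1, hMle, hAM, hAM'⟩ := hexM
  have hexY : ∃ Y, M ≤ p ^ Y := ⟨M, (Nat.lt_pow_self hp1).le⟩
  let Y := Nat.find hexY
  have hYs : M ≤ p ^ Y := Nat.find_spec hexY
  have hYm : ∀ y, y < Y → p ^ y < M := fun y hy => not_le.1 (Nat.find_min hexY hy)
  have hYN : Y ≤ N := (Nat.find_min' hexY (Nat.lt_pow_self hp1).le).trans (by omega)
  have hAY : A M = ∑ y ∈ Finset.range Y,
      ((p : ℤ) * (2 ^ a M y * p ^ y) - 2 ^ a M (y + 1) * p ^ (y + 1)) := by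
    symm
    apply Finset.sum_subset (Finset.range_mono hYN)
    intro y _ hy
    rw [Finset.mem_range, not_lt] at hy
    have h1 : M ≤ p ^ y := hYs.trans (Nat.pow_le_pow_right (by omega) hy)
    have h2 : M ≤ p ^ (y + 1) := h1.trans (Nat.pow_le_pow_right (by omega) (by omega))
    rw [hzero M y h1, hzero M (y + 1) h2]; ring
  have hB : (n : ℤ) ≤ ∑ y ∈ Finset.range Y, ((p : ℤ) * (2 ^ a M y * p ^ y)) +
        (2 * 2 ^ k - 1) * (2 ^ a M 0 * p ^ 0) := by
    have h1 := hAstep M hM1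
    rw [hAY, Finset.sum_sub_distrib] at h1
    have h2 : (0 : ℤ) ≤ ∑ y ∈ Finset.range Y, ((2 : ℤ) ^ a M (y + 1) * p ^ (y + 1)) :=
      Finset.sum_nonneg (fun y _ => by positivity)
    have h3 : (M : ℤ) ≤ 2 ^ a M 0 * p ^ 0 := by exact_mod_cast hM M 0
    have h4 : (p : ℤ) ≤ 2 * 2 ^ k - 1 := by
      have h5 : (p : ℤ) = 2 ^ k + 1 := by exact_mod_cast hpk
      have h6 : (2 : ℤ) ^ 1 ≤ 2 ^ k := pow_le_pow_right₀ (by norm_num) hk1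
      linarith
    have h5 : (p : ℤ) * M ≤ (2 * 2 ^ k - 1) * (2 ^ a M 0 * p ^ 0) :=
      mul_le_mul h4 h3 (by positivity) (le_trans (by positivity) h4)
    linarith
  obtain ⟨S, hS, hSn⟩ := Ap_key p k hp hk1 hpk M (a M) (hanti M) (hM M)
    (hlt M 0 (by simp; omega)) Y (fun y hy => hlt M y (by have := hYm y hy; omega)) n
    (by rw [hzero M Y hYs]; simp) (by rw [← hAY]; exact hAM) hB
  have hne : S.Nonempty := by
    rw [Finset.nonempty_iff_ne_empty]
    rintro rfl
    simp at hSn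
    omega
  refine ⟨S, hne, ?_, hSn, ?_⟩
  · intro b hb
    obtain ⟨⟨x, y, _, h⟩, _⟩ := hS b hb
    exact ⟨x, y, h⟩
  · intro b hb
    have h1 := (hS b hb).2.2
    have h2 := (hS _ (S.min'_mem hne)).2.1
    exact h1.trans_le (Nat.mul_le_mul_left _ h2)
end

section
/- For every odd integer p > 1, the set S = {p} ∪ {2^k : 1 ≤ k ≤ ⌈log₂ p⌉} satisfies: every integer x with p ≤ x ≤ p + |S| can be written as a sum of distinct elements of S. -/
theorem even_rep (n : ℕ) : ∀ j : ℕ, j < 2 ^ n →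
    ∃ T ⊆ (Finset.Icc 1 n).image (fun k => 2 ^ k), (∑ t ∈ T, t) = 2 * j := by
  induction n with
  | zero =>
    intro j hj
    exact ⟨∅, by simp, by simp at hj; simp [hj]⟩
  | succ n ih =>
    intro j hj
    have hsub : (Finset.Icc 1 n).image (fun k => 2 ^ k) ⊆
        (Finset.Icc 1 (n + 1)).image (fun k => 2 ^ k) :=
      Finset.image_subset_image (Finset.Icc_subset_Icc le_rfl (Nat.le_succ n))
    by_cases h : j < 2 ^ n
    · obtain ⟨T, hT, hs⟩ := ih j h
      exact ⟨T, hT.trans hsub, hs⟩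
    · have h2 : 2 ^ (n + 1) = 2 * 2 ^ n := by ring
      obtain ⟨T, hT, hs⟩ := ih (j - 2 ^ n) (by omega)
      have hn : 2 ^ (n + 1) ∉ T := by
        intro hm
        obtain ⟨k, hk, he⟩ := Finset.mem_image.1 (hT hm)
        have := Nat.pow_right_injective (le_refl 2) he
        rw [Finset.mem_Icc] at hk
        omega
      refine ⟨insert (2 ^ (n + 1)) T, ?_, ?_⟩
      · refine Finset.insert_subset ?_ (hT.trans hsub)
        exact Finset.mem_image.2 ⟨n + 1, by simp, rfl⟩
      · rw [Finset.sum_insert hn, hs]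
        omega

theorem add_two_le_pow (n : ℕ) (hn : 2 ≤ n) : n + 2 ≤ 2 ^ n := by
  induction n, hn using Nat.le_induction with
  | base => norm_num
  | succ n hn ih => rw [pow_succ]; omega

theorem subset_sums_cover (p : ℕ) (hp : Odd p) (hp1 : 1 < p) :
    ∀ x : ℕ, p ≤ x →
      x ≤ p + (insert p ((Finset.Icc 1 (Nat.clog 2 p)).image (fun k => 2 ^ k))).card →
      ∃ T ⊆ insert p ((Finset.Icc 1 (Nat.clog 2 p)).image (fun k => 2 ^ k)),
        (∑ t ∈ T, t) = x := by
  intro x hx hxc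
  have hle : p ≤ 2 ^ Nat.clog 2 p := Nat.le_pow_clog (by norm_num) p
  generalize Nat.clog 2 p = n at *
  have hcard : (insert p ((Finset.Icc 1 n).image (fun k => 2 ^ k))).card ≤ n + 1 := by
    refine (Finset.card_insert_le _ _).trans ?_
    have := Finset.card_image_le (s := Finset.Icc 1 n) (f := fun k => 2 ^ k)
    simp only [Nat.card_Icc] at this
    omega
  obtain ⟨q, hq⟩ := hp
  have hn : 2 ≤ n := by
    by_contra h
    have : 2 ^ n ≤ 2 ^ 1 := Nat.pow_le_pow_right (by norm_num) (by omega)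
    omega
  have h2 := add_two_le_pow n hn
  have hev : 2 ^ n = 2 * 2 ^ (n - 1) := by
    rw [← pow_succ']; congr 1; omega
  have hpn : p ∉ (Finset.Icc 1 n).image (fun k => 2 ^ k) := by
    intro hm
    obtain ⟨k, hk, he⟩ := Finset.mem_image.1 hm
    rw [Finset.mem_Icc] at hk
    have : 2 ^ k = 2 * 2 ^ (k - 1) := by
      rw [← pow_succ']; congr 1; omega
    omega
  rcases Nat.even_or_odd' x with ⟨j, hj | hj⟩
  · obtain ⟨T, hT, hs⟩ := even_rep n j (by omega)
    exact ⟨T, hT.trans (Finset.subset_insert _ _), by omega⟩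
  · obtain ⟨T, hT, hs⟩ := even_rep n (j - q) (by omega)
    refine ⟨insert p T, Finset.insert_subset_insert _ hT, ?_⟩
    rw [Finset.sum_insert (fun h => hpn (hT h)), hs]
    omega
end
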